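/- Let I be a ROS-UET instance on a network G=(V,E,c,v*) such that every vertex v ∈ V contains at least m jobs (n_v ≥ m for all v), and let H be a Hamiltonian cycle of G with total travel time c(H). Then there exists a feasible schedule for I with makespan at most c(H) + n. -/

import Mathlib

/-- A network: a connected simple graph with positive integer travel times
and a distinguished depot vertex. -/
structure Network (V : Type*) where
  G : SimpleGraph V
  conn : G.Connected
  c : V → V → ℕ
  csymm : ∀ u v : V, c u v = c v u
  cpos : ∀ u v : V, G.Adj u v → 0 < c u v
  depot : V

/-- A route with `s` stays; stay `k` (for `k < s`) is `(a k, v k, b k)`. -/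
structure Route (V : Type*) where
  s : ℕ
  a : ℕ → ℕ
  v : ℕ → V
  b : ℕ → ℕ

/-- The length of a route: the end of its last stay. -/
def Route.length {V : Type*} (R : Route V) : ℕ := R.b (R.s - 1)

/-- `R` is a valid route in the network `N`. -/
def IsRoute {V : Type*} (N : Network V) (R : Route V) : Prop :=
  0 < R.s ∧ R.v 0 = N.depot ∧ R.v (R.s - 1) = N.depot ∧ R.a 0 = 0 ∧
    (∀ k < R.s, R.a k ≤ R.b k) ∧
    ∀ k, k + 1 < R.s →
      N.G.Adj (R.v k) (R.v (k + 1)) ∧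
      R.a (k + 1) = R.b k + N.c (R.v k) (R.v (k + 1))

/-- Routes `R` (one per machine) are compatible with the (unit execution time)
schedule `S`: each machine stays at the location of each job while processing it. -/
def Compatible {V : Type*} {n m : ℕ} (loc : Fin n → V)
    (S : Fin n → Fin m → ℕ) (R : Fin m → Route V) : Prop :=
  ∀ (i : Fin n) (q : Fin m), ∃ k < (R q).s,
    (R q).v k = loc i ∧ (R q).a k ≤ S i q ∧ S i q + 1 ≤ (R q).b k

/-- A schedule for a ROS-UET instance is feasible. -/
def Feasible {V : Type*} {n m : ℕ} (N : Network V) (loc : Fin n → V)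
    (S : Fin n → Fin m → ℕ) : Prop :=
  (∀ (i j : Fin n) (q : Fin m), i ≠ j → S i q ≠ S j q) ∧
  (∀ (i : Fin n) (q r : Fin m), q ≠ r → S i q ≠ S i r) ∧
  ∃ R : Fin m → Route V, (∀ q, IsRoute N (R q)) ∧ Compatible loc S R

/-- The makespan of a schedule: the least `L` such that there are compatible
routes, each of length at most `L`. -/
noncomputable def makespan {V : Type*} {n m : ℕ} (N : Network V) (loc : Fin n → V)
    (S : Fin n → Fin m → ℕ) : ℕ :=
  sInf {L | ∃ R : Fin m → Route V, (∀ q, IsRoute N (R q)) ∧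
    Compatible loc S R ∧ ∀ q, Route.length (R q) ≤ L}

/-- The total travel time of a walk in a graph with travel times `c`. -/
def walkWeight {V : Type*} {G : SimpleGraph V} (c : V → V → ℕ) {u w : V}
    (p : G.Walk u w) : ℕ :=
  (p.darts.map fun d => c d.toProd.1 d.toProd.2).sum

lemma walkWeight_eq_sum {V : Type*} {G : SimpleGraph V} (c : V → V → ℕ) {u w : V}
    (p : G.Walk u w) :
    walkWeight c p = ∑ k ∈ Finset.range p.length, c (p.getVert k) (p.getVert (k + 1)) := by
  induction p with
  | nil => simp [walkWeight]
  | cons h p ih =>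
    rw [SimpleGraph.Walk.length_cons, Finset.sum_range_succ']
    simp only [SimpleGraph.Walk.getVert_cons_succ, SimpleGraph.Walk.getVert_zero]
    rw [← ih]
    simp [walkWeight, add_comm]


/-- For a ROS-UET instance in which every vertex contains at
least `m` jobs and a Hamiltonian cycle `H` of its network, there is a feasible
schedule with makespan at most `c(H) + n`. -/
theorem statement6 {V : Type*} [Fintype V] [DecidableEq V] {n m : ℕ}
    (N : Network V) (loc : Fin n → V)
    (hjobs : ∀ v : V, m ≤ (Finset.univ.filter (fun i : Fin n => loc i = v)).card)
    (u : V) (H : N.G.Walk u u) (hH : H.IsHamiltonianCycle) :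
    ∃ S : Fin n → Fin m → ℕ, Feasible N loc S ∧
      makespan N loc S ≤ walkWeight N.c H + n := by
  classical
  have hdep : N.depot ∈ H.support := hH.mem_support _
  obtain ⟨W, hWdef⟩ : ∃ W, W = H.rotate N.depot hdep := ⟨_, rfl⟩
  have hWc : W.IsCycle := by rw [hWdef]; exact hH.isCycle.rotate hdep
  have hWw : walkWeight N.c W = walkWeight N.c H := by
    rw [hWdef]
    unfold walkWeight
    exact ((H.rotate_darts N.depot hdep).perm.map _).sum_eq
  have hWs : ∀ v, v ∈ W.support := by
    intro v
    rw [hWdef, SimpleGraph.Walk.mem_support_rotate_iff]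
    exact hH.mem_support v
  have hlen : 3 ≤ W.length := hWc.three_le_length
  have hex : ∀ v : V, ∃ k, k < W.length ∧ W.getVert k = v := by
    intro v
    obtain ⟨k, hk, hkl⟩ := SimpleGraph.Walk.mem_support_iff_exists_getVert.mp (hWs v)
    rcases Nat.lt_or_ge k W.length with h | h
    · exact ⟨k, h, hk⟩
    · refine ⟨0, by omega, ?_⟩
      have : k = W.length := by omega
      subst this
      rw [SimpleGraph.Walk.getVert_length] at hk
      rw [SimpleGraph.Walk.getVert_zero, hk]
  choose pos hpos hposv using hex
  have hposu : ∀ k, k < W.length → pos (W.getVert k) = k := by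
    intro k hk
    exact hWc.getVert_injOn' (by rw [Set.mem_ofPred_eq]; have := hpos (W.getVert k); omega)
      (by rw [Set.mem_ofPred_eq]; omega) (hposv _)
  let F : V → Finset (Fin n) := fun v => Finset.univ.filter (fun i : Fin n => loc i = v)
  let cnt : V → ℕ := fun v => (F v).card
  let rk : Fin n → ℕ := fun i => ((F (loc i)).filter (fun j => j < i)).card
  have hrk : ∀ i, rk i < cnt (loc i) := by
    intro i
    apply Finset.card_lt_card
    rw [Finset.ssubset_iff_of_subset (Finset.filter_subset _ _)]
    exact ⟨i, by simp [F], by simp⟩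
  have hrklt : ∀ i j, i < j → loc i = loc j → rk i < rk j := by
    intro i j hij hl
    apply Finset.card_lt_card
    rw [Finset.ssubset_iff_of_subset]
    · exact ⟨i, by simp [F, hl, hij], by simp⟩
    · intro x hx
      simp only [F, Finset.mem_filter, Finset.mem_univ, true_and] at hx ⊢
      exact ⟨hx.1.trans hl, hx.2.trans hij⟩
  have hrkne : ∀ i j, i ≠ j → loc i = loc j → rk i ≠ rk j := by
    intro i j hij hl
    rcases lt_or_gt_of_ne hij with h | h
    · exact (hrklt i j h hl).ne
    · exact (hrklt j i h hl.symm).ne'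
  let T : ℕ → ℕ := fun k => ∑ l ∈ Finset.range k,
    (cnt (W.getVert l) + N.c (W.getVert l) (W.getVert (l + 1)))
  have hT : ∀ k, T (k + 1) =
      T k + (cnt (W.getVert k) + N.c (W.getVert k) (W.getVert (k + 1))) :=
    fun k => Finset.sum_range_succ _ _
  have hTm : Monotone T := monotone_nat_of_le_succ (fun k => by rw [hT]; omega)
  have hsum : ∑ l ∈ Finset.range W.length, cnt (W.getVert l) = n := by
    have h := Finset.card_eq_sum_card_fiberwise (s := (Finset.univ : Finset (Fin n)))
      (t := Finset.range W.length) (f := fun i => pos (loc i))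
      (fun i _ => by simpa using hpos (loc i))
    rw [Finset.card_univ, Fintype.card_fin] at h
    refine Eq.trans ?_ h.symm
    apply Finset.sum_congr rfl
    intro l hl
    rw [Finset.mem_range] at hl
    apply congrArg Finset.card
    ext i
    simp only [F, Finset.mem_filter, Finset.mem_univ, true_and]
    constructor
    · intro h; rw [h]; exact hposu l hl
    · intro h; rw [← h]; exact (hposv _).symm
  have hTend : T W.length = walkWeight N.c H + n := by
    rw [← hWw, walkWeight_eq_sum, ← hsum, add_comm]
    exact Finset.sum_add_distrib
  let S : Fin n → Fin m → ℕ := fun i q => T (pos (loc i)) + (rk i + q.val) % cnt (loc i)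
  let R : Route V :=
    { s := W.length + 1
      a := T
      v := W.getVert
      b := fun k => T k + if k < W.length then cnt (W.getVert k) else 0 }
  have hmod : ∀ i (q : Fin m), (rk i + q.val) % cnt (loc i) < cnt (loc i) :=
    fun i q => Nat.mod_lt _ (by have := hrk i; omega)
  have hR : IsRoute N R := by
    refine ⟨Nat.succ_pos _, W.getVert_zero, W.getVert_length, rfl, ?_, ?_⟩
    · intro k _
      exact Nat.le_add_right _ _
    · intro k hk
      have hk' : k < W.length := Nat.lt_of_succ_lt_succ hk
      refine ⟨W.adj_getVert_succ hk', ?_⟩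
      simp only [R, if_pos hk', hT]
      omega
  have hC : Compatible loc S (fun _ => R) := by
    intro i q
    refine ⟨pos (loc i), Nat.lt_succ_of_lt (hpos _), hposv _, Nat.le_add_right _ _, ?_⟩
    have := hmod i q
    simp only [R, S, if_pos (hpos (loc i)), hposv]
    omega
  have hsep : ∀ i j (q : Fin m), pos (loc i) < pos (loc j) → S i q < S j q := by
    intro i j q h
    have h1 := hTm (Nat.succ_le_of_lt h)
    have h2 := hT (pos (loc i))
    have h3 := hmod i q
    rw [hposv] at h2
    simp only [Nat.succ_eq_add_one] at h1
    simp only [S]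
    omega
  refine ⟨S, ⟨?_, ?_, fun _ => R, fun _ => hR, hC⟩, ?_⟩
  · intro i j q hij h
    rcases lt_trichotomy (pos (loc i)) (pos (loc j)) with hp | hp | hp
    · exact (hsep i j q hp).ne h
    · have hl : loc i = loc j := by rw [← hposv (loc i), hp, hposv]
      simp only [S, hl] at h
      have h' : rk i + q.val ≡ rk j + q.val [MOD cnt (loc j)] := Nat.add_left_cancel h
      have h'' := Nat.ModEq.add_right_cancel' _ h'
      exact hrkne i j hij hl (h''.eq_of_lt_of_lt (hl ▸ hrk i) (hrk j))
    · exact (hsep j i q hp).ne h.symm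
  · intro i q r hqr h
    have h' : rk i + q.val ≡ rk i + r.val [MOD cnt (loc i)] := Nat.add_left_cancel h
    have h'' := Nat.ModEq.add_left_cancel' _ h'
    have hm : m ≤ cnt (loc i) := hjobs (loc i)
    exact hqr (Fin.ext (h''.eq_of_lt_of_lt (q.2.trans_le hm) (r.2.trans_le hm)))
  · apply Nat.sInf_le
    refine ⟨fun _ => R, fun _ => hR, hC, fun _ => ?_⟩
    simp only [Route.length, R, Nat.add_sub_cancel, lt_irrefl, if_false, hTend]
    exact le_refl _
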